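/- arXiv:1103.5605 — 2 statements merged into one kernel-verified Lean document; each statement's English description precedes it below -/
import Mathlib

section
/- Assume R(u) < 0 for all u > 0, and let W be a scale function for R which is locally absolutely continuous on [0,∞): there is a nonnegative locally integrable function W′ on (0,∞) with W(y) = W(0) + ∫_0^y W′(t) dt for all y ≥ 0. Then for every u > 0 all the integrals below are finite and −F(u)/R(u) = b·W(0) + ∫_0^∞ e^{−ux} ( b·W′(x) + ∫_(0,∞) (W(x) − W(x−ξ)) m(dξ) ) dx, where W(x−ξ) is understood as 0 when x − ξ < 0. -/
open MeasureTheory Filter Set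
open scoped ENNReal Topology

/-- A measure integrating a strictly positive finite function is s-finite. -/
theorem sFinite_of_lintegral_lt_top {X : Type*} [MeasurableSpace X] {ν : Measure X}
    {f : X → ℝ≥0∞} (hf : Measurable f) (hpos : ∀ᵐ x ∂ν, f x ≠ 0)
    (hint : ∫⁻ x, f x ∂ν < ⊤) : SFinite ν := by
  have : IsFiniteMeasure (ν.withDensity f) := isFiniteMeasure_withDensity hint.ne
  rw [← withDensity_inv_same hf hpos ((ae_lt_top hf hint.ne).mono fun _ h => h.ne)]
  infer_instance

theorem lintegral_eq_setLIntegral_Ioi {g : ℝ → ℝ≥0∞} (hg : ∀ x < 0, g x = 0) :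
    ∫⁻ x, g x = ∫⁻ x in Ioi 0, g x := by
  rw [setLIntegral_congr Ioi_ae_eq_Ici, ← lintegral_indicator measurableSet_Ici]
  congr 1
  ext x
  by_cases hx : 0 ≤ x
  · simp [hx]
  · simp [hx, hg x (not_le.1 hx)]

theorem setLIntegral_exp_neg_mul_Ioi {u : ℝ} (hu : 0 < u) (c : ℝ) :
    ENNReal.ofReal u * ∫⁻ x in Ioi c, ENNReal.ofReal (Real.exp (-(u * x)))
      = ENNReal.ofReal (Real.exp (-(u * c))) := by
  have hint := integrableOn_exp_mul_Ioi (neg_lt_zero.2 hu) c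
  have hval := integral_exp_mul_Ioi (neg_lt_zero.2 hu) c
  simp only [neg_mul] at hint hval
  rw [← ofReal_integral_eq_lintegral_ofReal hint (ae_of_all _ fun _ => (Real.exp_pos _).le),
    hval, ← ENNReal.ofReal_mul hu.le]
  congr 1
  field_simp

theorem aemeasurable_Ioi_of_integrableOn_Ioc {g : ℝ → ℝ}
    (hg : ∀ y > (0 : ℝ), IntegrableOn g (Ioc 0 y)) :
    AEMeasurable g (volume.restrict (Ioi 0)) := by
  rw [← iUnion_Ioc_eq_Ioi_self_iff (f := fun n : ℕ => (n : ℝ)) |>.2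
    fun x _ => exists_nat_ge x, aemeasurable_iUnion_iff]
  intro n
  rcases Nat.eq_zero_or_pos n with rfl | hn
  · simp
  · exact (hg n (by exact_mod_cast hn)).aestronglyMeasurable.aemeasurable

/-- Integration by parts for Laplace transforms: the transform of a density against `u` times
the transform of its primitive. -/
theorem ofReal_mul_laplace_eq_add_laplace_density {W W' : ℝ → ℝ} (hW0 : 0 ≤ W 0)
    (hW'nonneg : ∀ x > (0 : ℝ), 0 ≤ W' x)
    (hW'int : ∀ y > (0 : ℝ), IntegrableOn W' (Ioc 0 y))
    (hWftc : ∀ y ≥ (0 : ℝ), W y = W 0 + ∫ t in Ioc (0 : ℝ) y, W' t) {u : ℝ} (hu : 0 < u) :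
    ENNReal.ofReal u *
        ∫⁻ x in Ioi (0 : ℝ), ENNReal.ofReal (Real.exp (-(u * x))) * ENNReal.ofReal (W x)
      = ENNReal.ofReal (W 0) +
        ∫⁻ x in Ioi (0 : ℝ), ENNReal.ofReal (Real.exp (-(u * x))) * ENNReal.ofReal (W' x) := by
  set e : ℝ → ℝ≥0∞ := fun x => ENNReal.ofReal (Real.exp (-(u * x)))
  set w : ℝ → ℝ≥0∞ := fun x => ENNReal.ofReal (W' x)
  have hem : Measurable e := by fun_prop
  have hwm : AEMeasurable w (volume.restrict (Ioi 0)) :=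
    (aemeasurable_Ioi_of_integrableOn_Ioc hW'int).ennreal_ofReal
  have hk (x t : ℝ) : (Ici t).indicator e x * w t = e x * (Iic x).indicator w t := by
    by_cases h : t ≤ x <;> simp [h]
  have hprim (x : ℝ) (hx : 0 < x) :
      ENNReal.ofReal (W x) = ENNReal.ofReal (W 0) + ∫⁻ t in Ioi 0, (Iic x).indicator w t := by
    have hnn : 0 ≤ᵐ[volume.restrict (Ioc 0 x)] W' :=
      (ae_restrict_mem measurableSet_Ioc).mono fun t ht => hW'nonneg t ht.1
    rw [hWftc x hx.le, ENNReal.ofReal_add hW0 (integral_nonneg_of_ae hnn),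
      ofReal_integral_eq_lintegral_ofReal (hW'int x hx) hnn,
      setLIntegral_indicator measurableSet_Iic, inter_comm, Ioi_inter_Iic]
  have hmeas : AEMeasurable (Function.uncurry fun x t => (Ici t).indicator e x * w t)
      ((volume.restrict (Ioi 0)).prod (volume.restrict (Ioi 0))) := by
    refine AEMeasurable.mul (Measurable.aemeasurable ?_) hwm.comp_snd
    have : (fun p : ℝ × ℝ => (Ici p.2).indicator e p.1)
        = {p : ℝ × ℝ | p.2 ≤ p.1}.indicator fun p => e p.1 := by
      ext p
      simp [indicator]
    rw [this]
    exact (hem.comp measurable_fst).indicator (measurableSet_le measurable_snd measurable_fst)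
  have hsplit : ∫⁻ x in Ioi (0 : ℝ), e x * ENNReal.ofReal (W x)
      = (∫⁻ x in Ioi (0 : ℝ), e x) * ENNReal.ofReal (W 0)
        + ∫⁻ x in Ioi (0 : ℝ), ∫⁻ t in Ioi (0 : ℝ), (Ici t).indicator e x * w t := by
    rw [← lintegral_mul_const _ hem, ← lintegral_add_left (hem.mul_const _)]
    refine setLIntegral_congr_fun measurableSet_Ioi fun x hx => ?_
    simp only [hprim x hx, mul_add, hk]
    rw [lintegral_const_mul' _ _ ENNReal.ofReal_ne_top]
  have hinner (t : ℝ) (ht : 0 < t) :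
      ENNReal.ofReal u * ∫⁻ x in Ioi (0 : ℝ), (Ici t).indicator e x * w t = e t * w t := by
    rw [lintegral_mul_const _ (hem.indicator measurableSet_Ici), ← mul_assoc,
      setLIntegral_indicator measurableSet_Ici,
      inter_eq_left.2 (Ici_subset_Ioi.2 ht),
      ← setLIntegral_congr Ioi_ae_eq_Ici, setLIntegral_exp_neg_mul_Ioi hu]
  rw [hsplit, lintegral_lintegral_swap hmeas, mul_add, ← mul_assoc,
    setLIntegral_exp_neg_mul_Ioi hu, ← lintegral_const_mul' _ _ ENNReal.ofReal_ne_top]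
  congr 1
  · simp
  · exact setLIntegral_congr_fun measurableSet_Ioi hinner

/-- The Laplace transform of the increment `W x - W (x - ξ)` of a monotone function vanishing on
the negative half-line. -/
theorem laplace_sub_translate {W : ℝ → ℝ} (hWmono : Monotone W) (hWnonneg : ∀ x, 0 ≤ W x)
    (hWzero : ∀ x < (0 : ℝ), W x = 0) {u ξ : ℝ} (hu : 0 < u) (hξ : 0 < ξ)
    (hfin : ∫⁻ x in Ioi (0 : ℝ),
      ENNReal.ofReal (Real.exp (-(u * x))) * ENNReal.ofReal (W x) ≠ ⊤) :
    ∫⁻ x in Ioi (0 : ℝ),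
        ENNReal.ofReal (Real.exp (-(u * x))) * ENNReal.ofReal (W x - W (x - ξ))
      = ENNReal.ofReal (1 - Real.exp (-(u * ξ))) *
        ∫⁻ x in Ioi (0 : ℝ), ENNReal.ofReal (Real.exp (-(u * x))) * ENNReal.ofReal (W x) := by
  set L := ∫⁻ x in Ioi (0 : ℝ), ENNReal.ofReal (Real.exp (-(u * x))) * ENNReal.ofReal (W x)
    with hL
  have hWm := hWmono.measurable
  have hshift : ∫⁻ x in Ioi (0 : ℝ),
      ENNReal.ofReal (Real.exp (-(u * x))) * ENNReal.ofReal (W (x - ξ))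
        = ENNReal.ofReal (Real.exp (-(u * ξ))) * L := by
    rw [← lintegral_eq_setLIntegral_Ioi fun x hx => by simp [hWzero (x - ξ) (by linarith)],
      ← lintegral_add_right_eq_self _ ξ, hL,
      ← lintegral_eq_setLIntegral_Ioi fun x hx => by simp [hWzero x hx],
      ← lintegral_const_mul' _ _ ENNReal.ofReal_ne_top]
    congr 1
    ext x
    have hexp : Real.exp (-(u * (x + ξ))) = Real.exp (-(u * ξ)) * Real.exp (-(u * x)) := by
      rw [← Real.exp_add]
      ring_nf
    rw [add_sub_cancel_right, ← mul_assoc, hexp, ENNReal.ofReal_mul (Real.exp_pos _).le]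
  have hsum : (∫⁻ x in Ioi (0 : ℝ),
        ENNReal.ofReal (Real.exp (-(u * x))) * ENNReal.ofReal (W x - W (x - ξ)))
      + ENNReal.ofReal (Real.exp (-(u * ξ))) * L = L := by
    rw [← hshift, ← lintegral_add_left (by fun_prop), hL]
    congr 1
    ext x
    rw [← mul_add, ← ENNReal.ofReal_add (sub_nonneg.2 (hWmono (by linarith))) (hWnonneg _),
      sub_add_cancel]
  have hexp : Real.exp (-(u * ξ)) ≤ 1 := Real.exp_le_one_iff.2 (by nlinarith)
  have hone : ENNReal.ofReal (1 - Real.exp (-(u * ξ))) * L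
      + ENNReal.ofReal (Real.exp (-(u * ξ))) * L = L := by
    rw [← add_mul, ← ENNReal.ofReal_add (by linarith) (Real.exp_pos _).le, sub_add_cancel]
    simp
  exact (ENNReal.add_left_inj (ENNReal.mul_ne_top ENNReal.ofReal_ne_top hfin)).1
    (hsum.trans hone.symm)

theorem integrableOn_one_sub_exp_neg_mul {m : Measure ℝ}
    (hm : ∫⁻ ξ in Ioi (0 : ℝ), ENNReal.ofReal (min ξ 1) ∂m < ⊤) {u : ℝ} (hu : 0 < u) :
    IntegrableOn (fun ξ => 1 - Real.exp (-(u * ξ))) (Ioi 0) m := by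
  have hmin : IntegrableOn (fun ξ : ℝ => min ξ 1) (Ioi 0) m := by
    refine ⟨by fun_prop, ?_⟩
    rw [hasFiniteIntegral_iff_ofReal]
    · exact hm
    · exact (ae_restrict_mem measurableSet_Ioi).mono fun x hx => le_min (le_of_lt hx) zero_le_one
  refine Integrable.mono' (hmin.const_mul (max u 1)) (by fun_prop) ?_
  refine (ae_restrict_mem measurableSet_Ioi).mono fun x (hx : 0 < x) => ?_
  have h1 := Real.add_one_le_exp (-(u * x))
  have h2 : Real.exp (-(u * x)) ≤ 1 := Real.exp_le_one_iff.2 (by nlinarith)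
  have h3 := Real.exp_pos (-(u * x))
  rw [Real.norm_of_nonneg (by linarith)]
  rcases le_total x 1 with h | h
  · rw [min_eq_left h]
    nlinarith [le_max_left u 1]
  · rw [min_eq_right h]
    linarith [le_max_right u 1]

/-- Assume `R < 0` on `(0,∞)` and let `W` be the scale function of `R`
(`W = 0` on `(−∞,0)`, nondecreasing and continuous on `[0,∞)`, with
`∫_0^∞ e^{−ux} W(x) dx = −1/R(u)` for `u > 0`), locally absolutely continuous on
`[0,∞)` with nonnegative locally integrable density `W′`. Then for every `u > 0`
all the integrals below are finite and
`−F(u)/R(u) = b W(0) + ∫_0^∞ e^{−ux} ( b W′(x) + ∫_(0,∞) (W(x) − W(x−ξ)) m(dξ) ) dx`,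
where `W(x−ξ) = 0` whenever `x − ξ < 0`.  (All quantities are nonnegative, and the
identity is stated in `[0,∞]`.) -/
theorem stmt8 (b : ℝ) (hb : 0 ≤ b) (m : Measure ℝ)
    (hm : ∫⁻ ξ in Set.Ioi (0:ℝ), ENNReal.ofReal (min ξ 1) ∂m < ⊤)
    (F : ℝ → ℝ)
    (hF : ∀ u, F u = b * u - ∫ ξ in Set.Ioi (0:ℝ), (Real.exp (-(u * ξ)) - 1) ∂m)
    (α β : ℝ) (hα : 0 ≤ α) (μ : Measure ℝ)
    (hμ : ∫⁻ ξ in Set.Ioi (0:ℝ), ENNReal.ofReal (min (ξ ^ 2) 1) ∂μ < ⊤)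
    (R : ℝ → ℝ)
    (hR : ∀ u, R u = -α * u ^ 2 + β * u -
      ∫ ξ in Set.Ioi (0:ℝ),
        (Real.exp (-(u * ξ)) - 1 + (if ξ ≤ 1 then u * ξ else 0)) ∂μ)
    (hRneg : ∀ u > (0:ℝ), R u < 0)
    (W : ℝ → ℝ) (hWnonneg : ∀ x, 0 ≤ W x) (hWzero : ∀ x < (0:ℝ), W x = 0)
    (hWmono : MonotoneOn W (Set.Ici 0)) (hWcont : ContinuousOn W (Set.Ici 0))
    (hWlap : ∀ u > (0:ℝ),
      ∫⁻ x in Set.Ioi (0:ℝ), ENNReal.ofReal (Real.exp (-(u * x)) * W x)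
        = ENNReal.ofReal (-1 / R u))
    (W' : ℝ → ℝ) (hW'nonneg : ∀ x > (0:ℝ), 0 ≤ W' x)
    (hW'int : ∀ y > (0:ℝ), IntegrableOn W' (Set.Ioc 0 y))
    (hWftc : ∀ y ≥ (0:ℝ), W y = W 0 + ∫ t in Set.Ioc (0:ℝ) y, W' t) :
    ∀ u > (0:ℝ),
      (∫⁻ x in Set.Ioi (0:ℝ),
          ENNReal.ofReal (Real.exp (-(u * x))) *
            (ENNReal.ofReal (b * W' x)
              + ∫⁻ ξ in Set.Ioi (0:ℝ), ENNReal.ofReal (W x - W (x - ξ)) ∂m) < ⊤) ∧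
      ENNReal.ofReal (-F u / R u)
        = ENNReal.ofReal (b * W 0)
          + ∫⁻ x in Set.Ioi (0:ℝ),
              ENNReal.ofReal (Real.exp (-(u * x))) *
                (ENNReal.ofReal (b * W' x)
                  + ∫⁻ ξ in Set.Ioi (0:ℝ), ENNReal.ofReal (W x - W (x - ξ)) ∂m) := by
  intro u hu
  have hmono : Monotone W := by
    intro x y hxy
    rcases lt_or_ge x 0 with hx | hx
    · rw [hWzero x hx]
      exact hWnonneg y
    · exact hWmono hx (hx.trans hxy) hxy
  have hWm := hmono.measurable
  set L := ∫⁻ x in Ioi (0 : ℝ), ENNReal.ofReal (Real.exp (-(u * x))) * ENNReal.ofReal (W x)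
    with hL
  have hLval : L = ENNReal.ofReal (-1 / R u) := by
    rw [← hWlap u hu]
    simp only [hL, ENNReal.ofReal_mul (Real.exp_pos _).le]
  have hLfin : L ≠ ⊤ := hLval ▸ ENNReal.ofReal_ne_top
  have : SFinite (m.restrict (Ioi 0)) := by
    refine sFinite_of_lintegral_lt_top (f := fun ξ : ℝ => ENNReal.ofReal (min ξ 1))
      (by fun_prop) ?_ hm
    filter_upwards [ae_restrict_mem measurableSet_Ioi] with ξ (hξ : 0 < ξ)
    simpa using hξ
  have hint := integrableOn_one_sub_exp_neg_mul hm hu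
  have hnn : 0 ≤ᵐ[m.restrict (Ioi 0)] fun ξ => 1 - Real.exp (-(u * ξ)) := by
    filter_upwards [ae_restrict_mem measurableSet_Ioi] with ξ (hξ : 0 < ξ)
    exact sub_nonneg.2 (Real.exp_le_one_iff.2 (by nlinarith))
  have hFu : F u = b * u + ∫ ξ in Ioi (0 : ℝ), (1 - Real.exp (-(u * ξ))) ∂m := by
    rw [hF, sub_eq_add_neg, ← integral_neg]
    simp only [neg_sub]
  have hjump : ∫⁻ x in Ioi (0 : ℝ), ENNReal.ofReal (Real.exp (-(u * x))) *
        ∫⁻ ξ in Ioi (0 : ℝ), ENNReal.ofReal (W x - W (x - ξ)) ∂m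
      = ENNReal.ofReal (∫ ξ in Ioi (0 : ℝ), (1 - Real.exp (-(u * ξ))) ∂m) * L := by
    simp_rw [← lintegral_const_mul' _ _ ENNReal.ofReal_ne_top]
    rw [lintegral_lintegral_swap (by fun_prop), ofReal_integral_eq_lintegral_ofReal hint hnn,
      ← lintegral_mul_const' _ _ hLfin]
    exact setLIntegral_congr_fun measurableSet_Ioi fun ξ hξ =>
      laplace_sub_translate hmono hWnonneg hWzero hu hξ hLfin
  have hsplit : ∫⁻ x in Ioi (0 : ℝ), ENNReal.ofReal (Real.exp (-(u * x))) *
        (ENNReal.ofReal (b * W' x)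
          + ∫⁻ ξ in Ioi (0 : ℝ), ENNReal.ofReal (W x - W (x - ξ)) ∂m)
      = ENNReal.ofReal b *
          (∫⁻ x in Ioi (0 : ℝ), ENNReal.ofReal (Real.exp (-(u * x))) * ENNReal.ofReal (W' x))
        + ENNReal.ofReal (∫ ξ in Ioi (0 : ℝ), (1 - Real.exp (-(u * ξ))) ∂m) * L := by
    have hW'm := aemeasurable_Ioi_of_integrableOn_Ioc hW'int
    rw [← hjump, ← lintegral_const_mul' _ _ ENNReal.ofReal_ne_top,
      ← lintegral_add_left' (by fun_prop)]
    congr 1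
    ext x
    rw [mul_add, ENNReal.ofReal_mul hb]
    ring
  have hid : ENNReal.ofReal (-F u / R u)
      = ENNReal.ofReal (b * W 0)
        + ∫⁻ x in Ioi (0 : ℝ), ENNReal.ofReal (Real.exp (-(u * x))) *
            (ENNReal.ofReal (b * W' x)
              + ∫⁻ ξ in Ioi (0 : ℝ), ENNReal.ofReal (W x - W (x - ξ)) ∂m) := by
    have hI := integral_nonneg_of_ae hnn
    have hmul : -F u / R u = F u * (-1 / R u) := by ring
    rw [hsplit, ENNReal.ofReal_mul hb, ← add_assoc, ← mul_add,
      ← ofReal_mul_laplace_eq_add_laplace_density (hWnonneg 0) hW'nonneg hW'int hWftc hu, ← hL,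
      ← mul_assoc, ← ENNReal.ofReal_mul hb, ← add_mul,
      ← ENNReal.ofReal_add (by positivity) hI, ← hFu, hLval, hmul, ENNReal.ofReal_mul]
    rw [hFu]
    exact add_nonneg (by positivity) hI
  refine ⟨?_, hid⟩
  exact (le_add_self.trans_eq hid.symm).trans_lt ENNReal.ofReal_lt_top
end

section
/- If α > 0, or if α = 0 and ∫_(0,1] ξ μ(dξ) = ∞, then R(u)/u → −∞ as u → ∞. If α = 0 and ∫_(0,1] ξ μ(dξ) < ∞, then lim_{u→∞} R(u)/u = β − ∫_(0,1] ξ μ(dξ), i.e. the limit equals minus the effective drift λ₀ = ∫_(0,1] ξ μ(dξ) − β. -/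
open MeasureTheory Filter Set
open scoped ENNReal Topology

lemma exp_neg_sub_one_add_nonneg (x : ℝ) : 0 ≤ Real.exp (-x) - 1 + x := by
  linarith [Real.add_one_le_exp (-x)]

lemma exp_neg_sub_one_add_le_sq {x : ℝ} (hx : 0 ≤ x) : Real.exp (-x) - 1 + x ≤ x ^ 2 := by
  have h1 : Real.exp (-x) * (1 + x) ≤ 1 := by
    have h2 : Real.exp (-x) * Real.exp x = 1 := by rw [← Real.exp_add]; simp
    have h3 := Real.add_one_le_exp x
    nlinarith [Real.exp_pos (-x)]
  have h4 : (Real.exp (-x) - 1 + x) * (1 + x) ≤ x ^ 2 * (1 + x) := by nlinarith [pow_nonneg hx 3]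
  exact le_of_mul_le_mul_right h4 (by linarith)

lemma abs_exp_neg_sub_one_le_one {x : ℝ} (hx : 0 ≤ x) : |Real.exp (-x) - 1| ≤ 1 := by
  rw [abs_le]
  constructor
  · linarith [Real.exp_pos (-x)]
  · linarith [Real.exp_le_one_iff.2 (neg_nonpos.2 hx)]

lemma measure_Ioi_one_lt_top {μ : Measure ℝ}
    (hμ : ∫⁻ ξ in Ioi (0:ℝ), ENNReal.ofReal (min (ξ ^ 2) 1) ∂μ < ⊤) : μ (Ioi 1) < ⊤ := by
  refine lt_of_le_of_lt ?_ hμ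
  calc μ (Ioi 1) = ∫⁻ _ in Ioi (1:ℝ), 1 ∂μ := by simp
    _ ≤ ∫⁻ ξ in Ioi (1:ℝ), ENNReal.ofReal (min (ξ ^ 2) 1) ∂μ := by
      refine setLIntegral_mono (by fun_prop) fun ξ hξ => ?_
      have h : (1:ℝ) ≤ ξ ^ 2 := one_le_pow₀ (le_of_lt hξ)
      simp [min_eq_right h]
    _ ≤ _ := lintegral_mono_set (Ioi_subset_Ioi zero_le_one)

lemma integrableOn_sq_Ioc {μ : Measure ℝ}
    (hμ : ∫⁻ ξ in Ioi (0:ℝ), ENNReal.ofReal (min (ξ ^ 2) 1) ∂μ < ⊤) :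
    IntegrableOn (fun ξ : ℝ => ξ ^ 2) (Ioc 0 1) μ := by
  refine (lintegral_ofReal_ne_top_iff_integrable (by fun_prop)
    (ae_of_all _ fun ξ => sq_nonneg ξ)).1 (ne_of_lt (lt_of_le_of_lt ?_ hμ))
  refine le_trans (setLIntegral_mono (by fun_prop) fun ξ hξ => ?_)
    (lintegral_mono_set Ioc_subset_Ioi_self)
  rw [min_eq_left (pow_le_one₀ hξ.1.le hξ.2)]

lemma integrableOn_compensated_Ioc {μ : Measure ℝ}
    (hμ : ∫⁻ ξ in Ioi (0:ℝ), ENNReal.ofReal (min (ξ ^ 2) 1) ∂μ < ⊤) {u : ℝ} (hu : 0 ≤ u) :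
    IntegrableOn (fun ξ => Real.exp (-(u * ξ)) - 1 + u * ξ) (Ioc 0 1) μ := by
  refine ((integrableOn_sq_Ioc hμ).const_mul (u ^ 2)).mono' (by fun_prop) ?_
  refine (ae_restrict_iff' measurableSet_Ioc).2 (ae_of_all _ fun ξ hξ => ?_)
  rw [Real.norm_of_nonneg (exp_neg_sub_one_add_nonneg _), ← mul_pow]
  exact exp_neg_sub_one_add_le_sq (mul_nonneg hu hξ.1.le)

lemma norm_exp_neg_mul_sub_one_le {u ξ : ℝ} (hu : 0 ≤ u) (hξ : ξ ∈ Ioi (1:ℝ)) :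
    ‖Real.exp (-(u * ξ)) - 1‖ ≤ 1 :=
  abs_exp_neg_sub_one_le_one (mul_nonneg hu (zero_le_one.trans (le_of_lt hξ)))

lemma integrableOn_exp_neg_sub_one_Ioi {μ : Measure ℝ} (hμ : μ (Ioi 1) < ⊤) {u : ℝ}
    (hu : 0 ≤ u) : IntegrableOn (fun ξ => Real.exp (-(u * ξ)) - 1) (Ioi 1) μ := by
  refine IntegrableOn.of_bound hμ (by fun_prop) 1 ?_
  exact (ae_restrict_iff' measurableSet_Ioi).2
    (ae_of_all _ fun ξ hξ => norm_exp_neg_mul_sub_one_le hu hξ)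

/-- The small-jump and large-jump parts of the Lévy integral. -/
lemma integral_compensated_eq_add {μ : Measure ℝ}
    (hμ : ∫⁻ ξ in Ioi (0:ℝ), ENNReal.ofReal (min (ξ ^ 2) 1) ∂μ < ⊤) {u : ℝ} (hu : 0 ≤ u) :
    ∫ ξ in Ioi (0:ℝ), (Real.exp (-(u * ξ)) - 1 + (if ξ ≤ 1 then u * ξ else 0)) ∂μ =
      (∫ ξ in Ioc (0:ℝ) 1, (Real.exp (-(u * ξ)) - 1 + u * ξ) ∂μ) +
        ∫ ξ in Ioi (1:ℝ), (Real.exp (-(u * ξ)) - 1) ∂μ := by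
  have hs : EqOn (fun ξ => Real.exp (-(u * ξ)) - 1 + (if ξ ≤ 1 then u * ξ else 0))
      (fun ξ => Real.exp (-(u * ξ)) - 1 + u * ξ) (Ioc 0 1) := fun ξ hξ => by simp [hξ.2]
  have hl : EqOn (fun ξ => Real.exp (-(u * ξ)) - 1 + (if ξ ≤ 1 then u * ξ else 0))
      (fun ξ => Real.exp (-(u * ξ)) - 1) (Ioi 1) := fun ξ hξ => by simp [not_le.2 (mem_Ioi.1 hξ)]
  rw [← Ioc_union_Ioi_eq_Ioi zero_le_one, setIntegral_union (Ioc_disjoint_Ioi le_rfl)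
    measurableSet_Ioi
    ((integrableOn_congr_fun hs measurableSet_Ioc).2 (integrableOn_compensated_Ioc hμ hu))
    ((integrableOn_congr_fun hl measurableSet_Ioi).2
      (integrableOn_exp_neg_sub_one_Ioi (measure_Ioi_one_lt_top hμ) hu)),
    setIntegral_congr_fun measurableSet_Ioc hs, setIntegral_congr_fun measurableSet_Ioi hl]

lemma tendsto_integral_exp_neg_sub_one_div {μ : Measure ℝ} (hμ : μ (Ioi 1) < ⊤) :
    Tendsto (fun u : ℝ => (∫ ξ in Ioi (1:ℝ), (Real.exp (-(u * ξ)) - 1) ∂μ) / u) atTop (𝓝 0) := by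
  refine squeeze_zero_norm' (a := fun u : ℝ => μ.real (Ioi 1) / u) ?_
    (tendsto_const_nhds.div_atTop tendsto_id)
  filter_upwards [eventually_gt_atTop 0] with u hu
  rw [norm_div, Real.norm_of_nonneg hu.le]
  gcongr
  simpa using norm_setIntegral_le_of_norm_le_const hμ
    fun ξ hξ => norm_exp_neg_mul_sub_one_le hu.le hξ

lemma tendsto_compensated_div {ξ : ℝ} (hξ : 0 ≤ ξ) :
    Tendsto (fun u : ℝ => (Real.exp (-(u * ξ)) - 1 + u * ξ) / u) atTop (𝓝 ξ) := by
  have h0 : Tendsto (fun u : ℝ => (Real.exp (-(u * ξ)) - 1) / u) atTop (𝓝 0) := by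
    refine squeeze_zero_norm' (a := fun u : ℝ => 1 / u) ?_
      (tendsto_const_nhds.div_atTop tendsto_id)
    filter_upwards [eventually_gt_atTop 0] with u hu
    rw [norm_div, Real.norm_of_nonneg hu.le]
    gcongr
    exact abs_exp_neg_sub_one_le_one (mul_nonneg hu.le hξ)
  have h1 := h0.add_const ξ
  rw [zero_add] at h1
  refine h1.congr' ?_
  filter_upwards [eventually_gt_atTop 0] with u hu
  field_simp

lemma tendsto_integral_compensated_div_of_lt_top {μ : Measure ℝ}
    (hfin : ∫⁻ ξ in Ioc (0:ℝ) 1, ENNReal.ofReal ξ ∂μ < ⊤) :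
    Tendsto (fun u : ℝ => (∫ ξ in Ioc (0:ℝ) 1, (Real.exp (-(u * ξ)) - 1 + u * ξ) ∂μ) / u) atTop
      (𝓝 (∫ ξ in Ioc (0:ℝ) 1, ξ ∂μ)) := by
  have hint : Integrable (fun ξ : ℝ => ξ) (μ.restrict (Ioc 0 1)) :=
    (lintegral_ofReal_ne_top_iff_integrable (by fun_prop)
      ((ae_restrict_iff' measurableSet_Ioc).2 (ae_of_all _ fun ξ hξ => hξ.1.le))).1 hfin.ne
  simp_rw [← integral_div]
  refine tendsto_integral_filter_of_dominated_convergence (fun ξ => ξ)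
    (Eventually.of_forall fun u => by fun_prop) ?_ hint ?_
  · filter_upwards [eventually_gt_atTop 0] with u hu
    refine (ae_restrict_iff' measurableSet_Ioc).2 (ae_of_all _ fun ξ hξ => ?_)
    rw [Real.norm_of_nonneg (div_nonneg (exp_neg_sub_one_add_nonneg _) hu.le), div_le_iff₀ hu]
    linarith [Real.exp_le_one_iff.2 (neg_nonpos.2 (mul_nonneg hu.le hξ.1.le))]
  · exact (ae_restrict_iff' measurableSet_Ioc).2
      (ae_of_all _ fun ξ hξ => tendsto_compensated_div hξ.1.le)

lemma tendsto_integral_compensated_div_of_eq_top {μ : Measure ℝ}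
    (hμ : ∫⁻ ξ in Ioi (0:ℝ), ENNReal.ofReal (min (ξ ^ 2) 1) ∂μ < ⊤)
    (htop : ∫⁻ ξ in Ioc (0:ℝ) 1, ENNReal.ofReal ξ ∂μ = ⊤) :
    Tendsto (fun u : ℝ => (∫ ξ in Ioc (0:ℝ) 1, (Real.exp (-(u * ξ)) - 1 + u * ξ) ∂μ) / u) atTop
      atTop := by
  refine ENNReal.tendsto_ofReal_nhds_top.1 ?_
  have hlim : ⊤ ≤ liminf (fun u : ℝ => ∫⁻ ξ in Ioc (0:ℝ) 1,
      ENNReal.ofReal ((Real.exp (-(u * ξ)) - 1 + u * ξ) / u) ∂μ) atTop := by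
    refine le_trans (le_of_eq ?_) (lintegral_liminf_le fun u => by fun_prop)
    rw [← htop]
    refine setLIntegral_congr_fun measurableSet_Ioc fun ξ hξ => ?_
    exact (ENNReal.tendsto_ofReal (tendsto_compensated_div hξ.1.le)).liminf_eq.symm
  refine (tendsto_of_le_liminf_of_limsup_le hlim le_top).congr' ?_
  filter_upwards [eventually_gt_atTop 0] with u hu
  rw [← integral_div, ofReal_integral_eq_lintegral_ofReal
    ((integrableOn_compensated_Ioc hμ hu.le).div_const _)
    (ae_of_all _ fun ξ => div_nonneg (exp_neg_sub_one_add_nonneg _) hu.le)]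

/-- If `α > 0`, or `α = 0` and `∫_(0,1] ξ μ(dξ) = ∞`, then
`R(u)/u → −∞` as `u → ∞`.  If `α = 0` and `∫_(0,1] ξ μ(dξ) < ∞`, then
`R(u)/u → β − ∫_(0,1] ξ μ(dξ)` as `u → ∞`, i.e. the limit is minus the effective drift
`λ₀ = ∫_(0,1] ξ μ(dξ) − β`. -/
theorem stmt10 (α β : ℝ) (hα : 0 ≤ α) (μ : Measure ℝ)
    (hμ : ∫⁻ ξ in Set.Ioi (0:ℝ), ENNReal.ofReal (min (ξ ^ 2) 1) ∂μ < ⊤)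
    (R : ℝ → ℝ)
    (hR : ∀ u, R u = -α * u ^ 2 + β * u -
      ∫ ξ in Set.Ioi (0:ℝ),
        (Real.exp (-(u * ξ)) - 1 + (if ξ ≤ 1 then u * ξ else 0)) ∂μ) :
    ((0 < α ∨ (α = 0 ∧ ∫⁻ ξ in Set.Ioc (0:ℝ) 1, ENNReal.ofReal ξ ∂μ = ⊤)) →
      Tendsto (fun u => R u / u) atTop atBot) ∧
    ((α = 0 ∧ ∫⁻ ξ in Set.Ioc (0:ℝ) 1, ENNReal.ofReal ξ ∂μ < ⊤) →
      Tendsto (fun u => R u / u) atTop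
        (𝓝 (β - ∫ ξ in Set.Ioc (0:ℝ) 1, ξ ∂μ))) := by
  set J : ℝ → ℝ := fun u => (∫ ξ in Ioc (0:ℝ) 1, (Real.exp (-(u * ξ)) - 1 + u * ξ) ∂μ) / u
    with hJ
  set L : ℝ → ℝ := fun u => (∫ ξ in Ioi (1:ℝ), (Real.exp (-(u * ξ)) - 1) ∂μ) / u with hL
  have hL0 : Tendsto L atTop (𝓝 0) :=
    tendsto_integral_exp_neg_sub_one_div (measure_Ioi_one_lt_top hμ)
  have hR_div : (fun u => -α * u + β - L u - J u) =ᶠ[atTop] fun u => R u / u := by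
    filter_upwards [eventually_gt_atTop 0] with u hu
    rw [hR, integral_compensated_eq_add hμ hu.le, hJ, hL]
    field_simp
    ring
  constructor
  · rintro (hpos | ⟨rfl, htop⟩)
    · have h1 : Tendsto (fun u => -α * u + (β - L u)) atTop atBot :=
        (tendsto_id.const_mul_atTop_of_neg (neg_lt_zero.2 hpos)).atBot_add
          (tendsto_const_nhds.sub hL0)
      refine (tendsto_atBot_mono' atTop ?_ h1).congr' hR_div
      filter_upwards [eventually_gt_atTop 0] with u hu
      have : 0 ≤ J u := div_nonneg (integral_nonneg fun ξ => exp_neg_sub_one_add_nonneg _) hu.le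
      linarith
    · have h1 : Tendsto (fun u => (β - L u) + -J u) atTop atBot :=
        (tendsto_const_nhds.sub hL0).add_atBot (tendsto_neg_atTop_atBot.comp
          (tendsto_integral_compensated_div_of_eq_top hμ htop))
      refine Tendsto.congr' (EventuallyEq.trans (.of_eq ?_) hR_div) h1
      ext u
      ring
  · rintro ⟨rfl, hfin⟩
    have h1 := (hL0.const_sub β).sub (tendsto_integral_compensated_div_of_lt_top hfin)
    rw [sub_zero] at h1
    refine Tendsto.congr' (EventuallyEq.trans (.of_eq ?_) hR_div) h1
    ext u
    simp [hJ]
end
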